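/- arXiv:2306.04638 — 3 statements merged into one kernel-verified Lean document; each statement's English description precedes it below -/
import Mathlib

section
/- The convergent series ∑_{k=1}^∞ 1/(k·2^k·C(3k,k)) equals π/10 − (log 2)/5. -/
open scoped BigOperators

theorem integral_pow_mul_one_sub_pow (m n : ℕ) :
    ∫ x in (0 : ℝ)..1, x ^ m * (1 - x) ^ n =
      (m.factorial * n.factorial : ℝ) / (m + n + 1).factorial := by
  induction n generalizing m with
  | zero =>
    simp only [pow_zero, mul_one, integral_pow, Nat.factorial_zero, Nat.cast_one, add_zero,
      Nat.factorial_succ]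
    have := Nat.factorial_ne_zero m
    push_cast
    field_simp
    simp
  | succ n ih =>
    have hderiv (x : ℝ) : HasDerivAt (fun x : ℝ ↦ x ^ (m + 1) * (1 - x) ^ (n + 1))
        ((m + 1) * (x ^ m * (1 - x) ^ (n + 1)) - (n + 1) * (x ^ (m + 1) * (1 - x) ^ n)) x := by
      refine ((hasDerivAt_pow (m + 1) x).mul
        (((hasDerivAt_id x).const_sub 1).pow (n + 1))).congr_deriv ?_
      simp
      ring
    have key := intervalIntegral.integral_eq_sub_of_hasDerivAt (a := 0) (b := 1)
      (fun x _ ↦ hderiv x) (Continuous.intervalIntegrable (by fun_prop) _ _)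
    rw [intervalIntegral.integral_sub (Continuous.intervalIntegrable (by fun_prop) _ _)
      (Continuous.intervalIntegrable (by fun_prop) _ _), intervalIntegral.integral_const_mul,
      intervalIntegral.integral_const_mul, ih (m + 1)] at key
    have hm : (m + 1 : ℝ) ≠ 0 := by positivity
    have hf : (m + 1 + n + 1).factorial = (m + (n + 1) + 1).factorial := by congr 1; ring
    rw [hf] at key
    apply mul_left_cancel₀ hm
    simp only [Nat.factorial_succ m, Nat.factorial_succ n] at key ⊢
    push_cast at key ⊢
    simp only [ne_eq, Nat.add_eq_zero_iff, one_ne_zero, and_false, not_false_eq_true, zero_pow,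
      sub_self, mul_zero, zero_mul] at key
    linear_combination key

theorem integral_sq_pow_mul_one_sub_pow (k : ℕ) :
    ∫ y in (0 : ℝ)..1, y ^ (2 * (k + 1)) * (1 - y) ^ k / 2 ^ (k + 1) =
      1 / ((k + 1 : ℝ) * 2 ^ (k + 1) * (Nat.choose (3 * (k + 1)) (k + 1) : ℝ)) := by
  rw [intervalIntegral.integral_div, integral_pow_mul_one_sub_pow,
    Nat.cast_choose ℝ (by lia : k + 1 ≤ 3 * (k + 1)),
    show 3 * (k + 1) - (k + 1) = 2 * (k + 1) by lia,
    show 2 * (k + 1) + k + 1 = 3 * (k + 1) by lia, Nat.factorial_succ k]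
  push_cast
  field_simp

theorem hasSum_sq_pow_mul_one_sub_pow {y : ℝ} (h0 : 0 ≤ y) (h1 : y ≤ 1) :
    HasSum (fun k : ℕ ↦ y ^ (2 * (k + 1)) * (1 - y) ^ k / 2 ^ (k + 1))
      (y ^ 2 / (2 - y ^ 2 * (1 - y))) := by
  have hy : y ^ 2 * (1 - y) ≤ 1 :=
    mul_le_one₀ (pow_le_one₀ h0 h1) (by linarith) (by linarith)
  have hy0 : 0 ≤ y ^ 2 * (1 - y) := mul_nonneg (sq_nonneg y) (by linarith)
  have hterm (k : ℕ) : y ^ (2 * (k + 1)) * (1 - y) ^ k / 2 ^ (k + 1) =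
      y ^ 2 / 2 * (y ^ 2 * (1 - y) / 2) ^ k := by
    rw [div_pow, mul_pow, ← pow_mul, pow_succ 2 k, mul_add, pow_add]
    field_simp
  have hsum : y ^ 2 / (2 - y ^ 2 * (1 - y)) = y ^ 2 / 2 * (1 - y ^ 2 * (1 - y) / 2)⁻¹ := by
    rw [show 1 - y ^ 2 * (1 - y) / 2 = (2 - y ^ 2 * (1 - y)) / 2 by ring, inv_div]
    field_simp
  simp_rw [hterm, hsum]
  exact (hasSum_geometric_of_lt_one (by linarith) (by linarith)).mul_left _

theorem integral_sq_div_two_sub :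
    ∫ y in (0 : ℝ)..1, y ^ 2 / (2 - y ^ 2 * (1 - y)) = Real.pi / 10 - Real.log 2 / 5 := by
  have hq (y : ℝ) : 0 < y ^ 2 - 2 * y + 2 := by nlinarith [sq_nonneg (y - 1)]
  have hden {y : ℝ} (hy : 0 ≤ y) : 0 < 2 - y ^ 2 * (1 - y) := by
    rw [show 2 - y ^ 2 * (1 - y) = (y + 1) * (y ^ 2 - 2 * y + 2) by ring]
    exact mul_pos (by linarith) (hq y)
  have hderiv {y : ℝ} (hy : 0 ≤ y) : HasDerivAt
      (fun y : ℝ ↦ Real.log (y + 1) / 5 + 2 / 5 * Real.log (y ^ 2 - 2 * y + 2)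
        + 2 / 5 * Real.arctan (y - 1)) (y ^ 2 / (2 - y ^ 2 * (1 - y))) y := by
    have hy1 : y + 1 ≠ 0 := by linarith
    have hlog := (((hasDerivAt_id y).add_const 1).log hy1).div_const 5
    have hquad : HasDerivAt (fun y : ℝ ↦ y ^ 2 - 2 * y + 2) (2 * y - 2) y := by
      refine (((hasDerivAt_pow 2 y).sub ((hasDerivAt_id y).const_mul 2)).add_const 2).congr_deriv ?_
      simp
    have hatan := (((hasDerivAt_id y).sub_const 1).arctan).const_mul (2 / 5)
    refine ((hlog.add ((hquad.log (hq y).ne').const_mul (2 / 5))).add hatan).congr_deriv ?_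
    have h1 := (hq y).ne'
    simp only [id]
    rw [show 2 - y ^ 2 * (1 - y) = (y + 1) * (y ^ 2 - 2 * y + 2) by ring,
      show 1 + (y - 1) ^ 2 = y ^ 2 - 2 * y + 2 by ring]
    generalize hQ : y ^ 2 - 2 * y + 2 = Q at h1 ⊢
    field_simp
    rw [← hQ]
    ring
  have hnonneg {y : ℝ} (hy : y ∈ Set.uIcc (0 : ℝ) 1) : 0 ≤ y := by
    rw [Set.uIcc_of_le zero_le_one] at hy
    exact hy.1
  rw [intervalIntegral.integral_eq_sub_of_hasDerivAt (fun y hy ↦ hderiv (hnonneg hy))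
    (ContinuousOn.intervalIntegrable (ContinuousOn.div (by fun_prop) (by fun_prop)
      fun y hy ↦ (hden (hnonneg hy)).ne'))]
  norm_num [Real.arctan_neg, Real.arctan_one]
  ring

theorem sun_inv3k_one :
    ∑' k : ℕ, 1 / ((k + 1 : ℝ) * 2 ^ (k + 1) * (Nat.choose (3 * (k + 1)) (k + 1) : ℝ)) =
      Real.pi / 10 - Real.log 2 / 5 := by
  refine HasSum.tsum_eq ?_
  rw [← integral_sq_div_two_sub]
  simp_rw [← integral_sq_pow_mul_one_sub_pow]
  have hIoc {y : ℝ} (hy : y ∈ Set.uIoc (0 : ℝ) 1) : 0 ≤ y ∧ y ≤ 1 := by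
    rw [Set.uIoc_of_le zero_le_one] at hy
    exact ⟨hy.1.le, hy.2⟩
  refine intervalIntegral.hasSum_integral_of_dominated_convergence
    (fun k _ ↦ (1 / 2 : ℝ) ^ (k + 1))
    (fun k ↦ Continuous.aestronglyMeasurable (by fun_prop))
    (fun k ↦ .of_forall fun y hy ↦ ?_)
    (.of_forall fun y _ ↦ (summable_nat_add_iff 1).2 summable_geometric_two)
    (by simp) (.of_forall fun y hy ↦ hasSum_sq_pow_mul_one_sub_pow (hIoc hy).1 (hIoc hy).2)
  obtain ⟨h0, h1⟩ := hIoc hy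
  have h2 : 0 ≤ 1 - y := by linarith
  rw [Real.norm_of_nonneg (by positivity), div_pow, one_pow]
  gcongr
  exact mul_le_one₀ (pow_le_one₀ h0 h1) (pow_nonneg h2 k) (pow_le_one₀ h2 (by linarith))
end

section
/- The convergent series ∑_{k=1}^∞ (H_{3k} − H_k + 1/k)/(k·2^k·C(3k,k)) equals 2G/5 − (log 2)²/10, where G is Catalan's constant. -/
open scoped BigOperators

/-- The `m`-th harmonic number `H_m = ∑_{j=1}^m 1/j`. -/
noncomputable def harmonicNum (m : ℕ) : ℝ := ∑ j ∈ Finset.range m, 1 / (j + 1 : ℝ)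

/-- Catalan's constant `G = ∑_{n=0}^∞ (-1)^n/(2n+1)²`. -/
noncomputable def catalanG : ℝ := ∑' n : ℕ, (-1) ^ n / (2 * n + 1 : ℝ) ^ 2

open MeasureTheory Set Filter Topology Real

theorem hasSum_of_hasSum_of_eq {f g : ℕ → ℝ} {a b : ℝ} (hf : HasSum f a) (hfg : ∀ n, g n = f n)
    (hab : b = a) : HasSum g b := by
  rwa [funext hfg, hab]

theorem harmonicNum_succ (m : ℕ) : harmonicNum (m + 1) = harmonicNum m + 1 / (m + 1 : ℝ) := by
  simp [harmonicNum, Finset.sum_range_succ]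

theorem intervalIntegrable_mul_neg_log {q : ℝ → ℝ} {a b : ℝ} (hq : ContinuousOn q (uIcc a b)) :
    IntervalIntegrable (fun x => q x * -log x) volume a b :=
  (intervalIntegral.intervalIntegrable_log'.neg).continuousOn_mul hq

theorem integral_pow_mul_neg_log (n : ℕ) :
    ∫ x in (0 : ℝ)..1, x ^ n * -log x = 1 / (n + 1 : ℝ) ^ 2 := by
  have hn : (n + 1 : ℝ) ≠ 0 := by positivity
  have hc : Continuous fun x : ℝ =>
      x ^ (n + 1) * (1 / (n + 1 : ℝ) ^ 2) - x ^ n * (x * log x) * (1 / (n + 1)) := by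
    have := Real.continuous_mul_log
    fun_prop
  rw [intervalIntegral.integral_eq_sub_of_hasDerivAt_of_le zero_le_one hc.continuousOn
    (fun x hx => ?_) (intervalIntegrable_mul_neg_log (by fun_prop))]
  · simp
  · have hx0 : x ≠ 0 := hx.1.ne'
    have h := (((hasDerivAt_pow (n + 1) x).mul_const (1 / (n + 1 : ℝ) ^ 2))).sub
      (((hasDerivAt_pow n x).mul ((hasDerivAt_id x).mul (hasDerivAt_log hx0))).mul_const
        (1 / (n + 1 : ℝ)))
    refine h.congr_deriv ?_
    have hp : (n : ℝ) * x ^ (n - 1) * x = n * x ^ n := by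
      cases n with
      | zero => simp
      | succ k => simp [pow_succ, mul_assoc]
    simp only [Pi.mul_apply, id]
    field_simp
    push_cast
    linear_combination (-(n + 1) * log x) * hp

/-- The logarithmic beta integral at natural exponents. -/
theorem integral_pow_mul_one_sub_pow_mul_neg_log (n m : ℕ) :
    ∫ x in (0 : ℝ)..1, x ^ m * (1 - x) ^ n * -log x =
      (m.factorial * n.factorial / (m + n + 1).factorial : ℝ) *
        (harmonicNum (m + n + 1) - harmonicNum m) := by
  induction n generalizing m with
  | zero =>
    simp only [pow_zero, mul_one, integral_pow_mul_neg_log, add_zero, harmonicNum_succ]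
    rw [Nat.factorial_succ]
    have := m.factorial_ne_zero
    push_cast
    field_simp
    simp
  | succ n ih =>
    have h : ∀ x : ℝ, x ^ m * (1 - x) ^ (n + 1) * -log x =
        x ^ m * (1 - x) ^ n * -log x - x ^ (m + 1) * (1 - x) ^ n * -log x := fun x => by ring
    simp only [h]
    rw [intervalIntegral.integral_sub (intervalIntegrable_mul_neg_log (by fun_prop))
      (intervalIntegrable_mul_neg_log (by fun_prop)), ih, ih,
      show m + 1 + n + 1 = m + n + 1 + 1 by ring, show m + (n + 1) + 1 = m + n + 1 + 1 by ring]
    simp only [harmonicNum_succ, Nat.factorial_succ (m + n + 1), Nat.factorial_succ m,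
      Nat.factorial_succ n]
    have := (m + n + 1).factorial_ne_zero
    push_cast
    have : (m : ℝ) + n + 1 + 1 ≠ 0 := by positivity
    field_simp
    ring

theorem hasSum_integral_mul_neg_log {p : ℕ → ℝ → ℝ} {q : ℝ → ℝ} (hp : ∀ n, Continuous (p n))
    (hs : Summable fun n => ∫ x in (0 : ℝ)..1, |p n x| * -log x)
    (hq : ∀ x ∈ Ioo (0 : ℝ) 1, HasSum (fun n => p n x) (q x)) :
    HasSum (fun n => ∫ x in (0 : ℝ)..1, p n x * -log x) (∫ x in (0 : ℝ)..1, q x * -log x) := by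
  simp only [intervalIntegral.integral_of_le zero_le_one, integral_Ioc_eq_integral_Ioo] at hs ⊢
  have key := hasSum_integral_of_summable_integral_norm
    (μ := volume.restrict (Ioo (0 : ℝ) 1)) (F := fun n x => p n x * -log x) (fun n => ?_) ?_
  · refine hasSum_of_hasSum_of_eq key (fun _ => rfl) ?_
    refine setIntegral_congr_fun measurableSet_Ioo fun x hx => ?_
    exact ((hq x hx).mul_right _).tsum_eq.symm
  · exact (intervalIntegrable_iff_integrableOn_Ioo_of_le zero_le_one).mp
      (intervalIntegrable_mul_neg_log (hp n).continuousOn)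
  · convert hs using 2 with n
    refine setIntegral_congr_fun measurableSet_Ioo fun x hx => ?_
    have := log_nonpos hx.1.le hx.2.le
    simp [abs_of_nonpos this]

theorem integral_neg_log_div_one_sub :
    ∫ x in (0 : ℝ)..1, 1 / (1 - x) * -log x = π ^ 2 / 6 := by
  have hz : HasSum (fun n : ℕ => 1 / (n + 1 : ℝ) ^ 2) (π ^ 2 / 6) := by
    simpa using (hasSum_nat_add_iff' 1).mpr hasSum_zeta_two
  have h := hasSum_integral_mul_neg_log (p := fun n x => x ^ n) (q := fun x => 1 / (1 - x))
    (by fun_prop) ?_ fun x hx => ?_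
  · simp only [integral_pow_mul_neg_log] at h
    exact h.unique hz
  · refine hz.summable.congr fun n => ?_
    rw [← integral_pow_mul_neg_log]
    refine intervalIntegral.integral_congr fun x hx => ?_
    rw [uIcc_of_le zero_le_one] at hx
    simp [abs_of_nonneg hx.1]
  · simpa using hasSum_geometric_of_lt_one hx.1.le hx.2

theorem hasSum_neg_one_pow_mul_sq {x : ℝ} (hx : x ∈ Ioo (0 : ℝ) 1) :
    HasSum (fun n : ℕ => (-1) ^ n * x ^ (2 * n)) (1 / (1 + x ^ 2)) := by
  have h := hasSum_geometric_of_norm_lt_one (ξ := -x ^ 2) (by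
    rw [norm_neg, norm_pow, Real.norm_of_nonneg hx.1.le]
    exact pow_lt_one₀ hx.1.le hx.2 two_ne_zero)
  have e : (fun n : ℕ => (-x ^ 2) ^ n) = fun n => (-1) ^ n * x ^ (2 * n) := by
    ext n; rw [neg_pow, pow_mul]
  rw [e] at h
  simpa using h

theorem summable_integral_abs_alternating {d : ℕ} :
    Summable fun n : ℕ => ∫ x in (0 : ℝ)..1, |(-1) ^ n * x ^ (2 * n + d)| * -log x := by
  have hz : Summable (fun n : ℕ => 1 / (n + 1 : ℝ) ^ 2) := by
    simpa using (summable_nat_add_iff 1).mpr hasSum_zeta_two.summable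
  have hi : Function.Injective fun n : ℕ => 2 * n + d := fun a b h => by simpa using h
  refine (hz.comp_injective hi).congr fun n => ?_
  rw [Function.comp_apply, ← integral_pow_mul_neg_log]
  refine intervalIntegral.integral_congr fun x hx => ?_
  rw [uIcc_of_le zero_le_one] at hx
  simp [abs_mul, abs_of_nonneg hx.1]

theorem integral_neg_log_div_one_add_sq :
    ∫ x in (0 : ℝ)..1, 1 / (1 + x ^ 2) * -log x = catalanG := by
  have h := hasSum_integral_mul_neg_log (p := fun n x => (-1) ^ n * x ^ (2 * n))
    (by fun_prop) (summable_integral_abs_alternating (d := 0))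
    fun x hx => hasSum_neg_one_pow_mul_sq hx
  rw [← h.tsum_eq, catalanG]
  refine tsum_congr fun n => ?_
  simp only [mul_assoc]
  rw [intervalIntegral.integral_const_mul, integral_pow_mul_neg_log]
  push_cast
  ring

theorem hasSum_alternating_inv_sq :
    HasSum (fun n : ℕ => (-1) ^ n * (1 / (n + 1 : ℝ) ^ 2)) (π ^ 2 / 12) := by
  have hz : HasSum (fun n : ℕ => 1 / (n + 1 : ℝ) ^ 2) (π ^ 2 / 6) := by
    simpa using (hasSum_nat_add_iff' 1).mpr hasSum_zeta_two
  have hodd : HasSum (fun k : ℕ => 1 / ((2 * k + 1 : ℕ) + 1 : ℝ) ^ 2) (π ^ 2 / 24) := by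
    refine hasSum_of_hasSum_of_eq (hz.mul_left (1 / 4)) (fun k => ?_) ?_
    · push_cast; field_simp; ring
    · ring
  have hse : Summable (fun k : ℕ => 1 / ((2 * k : ℕ) + 1 : ℝ) ^ 2) :=
    hz.summable.comp_injective (i := fun k : ℕ => 2 * k) fun a b h => by simpa using h
  have hval := (hse.hasSum.even_add_odd (f := fun n : ℕ => 1 / (n + 1 : ℝ) ^ 2) hodd).unique hz
  have he := hse.hasSum
  rw [show ∑' k : ℕ, 1 / ((2 * k : ℕ) + 1 : ℝ) ^ 2 = π ^ 2 / 8 by linarith] at he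
  have := HasSum.even_add_odd (f := fun n : ℕ => (-1 : ℝ) ^ n * (1 / (n + 1 : ℝ) ^ 2))
    (by simpa using he) (by simpa [pow_succ] using hodd.neg)
  convert this using 1
  ring

theorem integral_mul_neg_log_div_one_add_sq :
    ∫ x in (0 : ℝ)..1, x / (1 + x ^ 2) * -log x = π ^ 2 / 48 := by
  have h := hasSum_integral_mul_neg_log (p := fun n x => (-1) ^ n * x ^ (2 * n + 1))
    (q := fun x => x / (1 + x ^ 2))
    (by fun_prop) (summable_integral_abs_alternating (d := 1))
    fun x hx => by
      refine hasSum_of_hasSum_of_eq ((hasSum_neg_one_pow_mul_sq hx).mul_right x) (fun n => ?_) ?_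
      all_goals ring
  refine h.unique ?_
  refine hasSum_of_hasSum_of_eq (hasSum_alternating_inv_sq.mul_right (1 / 4)) (fun n => ?_) ?_
  · simp only [mul_assoc]
    rw [intervalIntegral.integral_const_mul, integral_pow_mul_neg_log]
    push_cast
    field_simp
    ring
  · ring

theorem intervalIntegrable_neg_log_div_one_sub :
    IntervalIntegrable (fun x => 1 / (1 - x) * -log x) volume (1 / 2) 1 := by
  rw [intervalIntegrable_iff_integrableOn_Ioo_of_le (by norm_num)]
  refine Measure.integrableOn_of_bounded (M := 2) (by simp) (by fun_prop) ?_
  refine (ae_restrict_iff' measurableSet_Ioo).mpr (ae_of_all _ fun x hx => ?_)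
  have hx0 : 0 < x := by linarith [hx.1]
  have h1 : 0 < 1 - x := by linarith [hx.2]
  have hl : 0 ≤ -log x := by linarith [log_nonpos hx0.le hx.2.le]
  rw [Real.norm_of_nonneg (by positivity), one_div, inv_mul_le_iff₀ h1]
  have h2 := one_sub_inv_le_log_of_pos hx0
  have h3 : x⁻¹ ≤ 2 := by
    rw [inv_le_comm₀ hx0 two_pos]; linarith [hx.1]
  have h4 : x⁻¹ - 1 = (1 - x) * x⁻¹ := by field_simp
  nlinarith

theorem tendsto_log_mul_log_one_sub :
    Tendsto (fun y : ℝ => log y * log (1 - y)) (𝓝[>] 0) (𝓝 0) := by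
  have h : Tendsto (fun y : ℝ => (-2) * (y * log y)) (𝓝[>] 0) (𝓝 0) := by
    have := (Real.continuous_mul_log.const_mul (-2 : ℝ)).tendsto 0
    simpa using this.mono_left nhdsWithin_le_nhds
  refine squeeze_zero' ?_ ?_ h
  all_goals
    filter_upwards [Ioo_mem_nhdsGT (show (0 : ℝ) < 1 / 2 by norm_num)] with y hy
    have h0 := hy.1
    have hl : log y ≤ 0 := log_nonpos hy.1.le (by linarith [hy.2])
    have h1 : 0 < 1 - y := by linarith [hy.2]
  · exact mul_nonneg_of_nonpos_of_nonpos hl (log_nonpos h1.le (by linarith))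
  · have h2 := one_sub_inv_le_log_of_pos h1
    have h3 : (1 - y)⁻¹ ≤ 1 + 2 * y := by
      rw [inv_le_iff_one_le_mul₀ h1]; nlinarith [hy.2]
    nlinarith

theorem integral_neg_log_div_one_sub_half :
    ∫ x in (0 : ℝ)..(1 / 2), 1 / (1 - x) * -log x = π ^ 2 / 12 + log 2 ^ 2 / 2 := by
  have hJ : IntervalIntegrable (fun x => 1 / (1 - x) * -log x) volume 0 (1 / 2) := by
    refine intervalIntegrable_mul_neg_log (ContinuousOn.div₀ (by fun_prop) (by fun_prop) ?_)
    intro x hx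
    rw [uIcc_of_le (by norm_num)] at hx
    linarith [hx.2]
  have hK := intervalIntegrable_neg_log_div_one_sub
  have hadd := intervalIntegral.integral_add_adjacent_intervals hJ hK
  rw [integral_neg_log_div_one_sub] at hadd
  have hK' : IntervalIntegrable (fun x => 1 / x * -log (1 - x)) volume 0 (1 / 2) := by
    have := (hK.comp_sub_left 1).symm
    norm_num at this ⊢
    exact this
  have hsub : ∫ x in (0 : ℝ)..(1 / 2), 1 / x * -log (1 - x) =
      ∫ x in (1 / 2 : ℝ)..1, 1 / (1 - x) * -log x := by
    have := intervalIntegral.integral_comp_sub_left (a := 0) (b := 1 / 2)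
      (fun x : ℝ => 1 / (1 - x) * -log x) 1
    norm_num at this ⊢
    exact this
  have hparts := intervalIntegral.integral_eq_sub_of_hasDerivAt_of_tendsto
    (a := (0 : ℝ)) (b := 1 / 2) (f := fun y => log y * log (1 - y))
    (f' := fun x => 1 / (1 - x) * -log x - 1 / x * -log (1 - x)) (fa := 0)
    (fb := log (1 / 2) * log (1 - 1 / 2)) (by norm_num) (fun x hx => ?_) (hJ.sub hK')
    tendsto_log_mul_log_one_sub ?_
  · rw [intervalIntegral.integral_sub hJ hK', hsub] at hparts
    have hl : log (1 / 2) * log (1 - 1 / 2) = log 2 ^ 2 := by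
      rw [show (1 : ℝ) - 1 / 2 = 2⁻¹ by norm_num, one_div, log_inv]; ring
    rw [hl] at hparts
    linarith
  · have h1 : 1 - x ≠ 0 := by linarith [hx.2]
    have h := (hasDerivAt_log hx.1.ne').mul (((hasDerivAt_id x).const_sub 1).log h1)
    refine h.congr_deriv ?_
    simp only [id]
    ring
  · refine ContinuousAt.tendsto (ContinuousAt.mul ?_ ?_) |>.mono_left nhdsWithin_le_nhds
    · exact continuousAt_log (by norm_num)
    · exact ContinuousAt.log (by fun_prop) (by norm_num)

theorem integral_neg_log_div_two_sub :
    ∫ x in (0 : ℝ)..1, 1 / (2 - x) * -log x = π ^ 2 / 12 - log 2 ^ 2 / 2 := by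
  have hc : ContinuousOn (fun x : ℝ => 1 / (1 - x)) (uIcc 0 (1 / 2)) := by
    refine ContinuousOn.div₀ (by fun_prop) (by fun_prop) fun x hx => ?_
    rw [uIcc_of_le (by norm_num)] at hx
    linarith [hx.2]
  have hlog : ∫ x in (0 : ℝ)..(1 / 2), 1 / (1 - x) = log 2 := by
    have := intervalIntegral.integral_comp_sub_left (a := 0) (b := 1 / 2)
      (fun x : ℝ => 1 / x) 1
    rw [this, integral_one_div (by norm_num [uIcc_of_le])]
    norm_num
  have h := intervalIntegral.mul_integral_comp_mul_left (a := 0) (b := 1 / 2)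
      (f := fun x : ℝ => 1 / (2 - x) * -log x) 2
  rw [show (2 : ℝ) * 0 = 0 by norm_num, show (2 : ℝ) * (1 / 2) = 1 by norm_num] at h
  rw [← h, ← intervalIntegral.integral_const_mul]
  have e : ∫ x in (0 : ℝ)..(1 / 2), 2 * (1 / (2 - 2 * x) * -log (2 * x)) =
      ∫ x in (0 : ℝ)..(1 / 2), (1 / (1 - x) * -log x - log 2 * (1 / (1 - x))) := by
    simp only [intervalIntegral.integral_of_le (show (0 : ℝ) ≤ 1 / 2 by norm_num)]
    refine setIntegral_congr_fun measurableSet_Ioc fun x hx => ?_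
    have h1 : 1 - x ≠ 0 := by linarith [hx.2]
    have h2 : 2 - 2 * x ≠ 0 := by linarith [hx.2]
    simp only [log_mul two_ne_zero hx.1.ne']
    field_simp
    ring
  rw [e, intervalIntegral.integral_sub (intervalIntegrable_mul_neg_log hc)
    (hc.intervalIntegrable.const_mul _), intervalIntegral.integral_const_mul, hlog,
    integral_neg_log_div_one_sub_half]
  ring

theorem integral_neg_log_mul_generating_function :
    ∫ x in (0 : ℝ)..1, (1 - x) ^ 2 / (2 - x * (1 - x) ^ 2) * -log x =
      2 * catalanG / 5 - log 2 ^ 2 / 10 := by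
  have hne : ∀ x ∈ uIcc (0 : ℝ) 1, 2 - x ≠ 0 := fun x hx => by
    rw [uIcc_of_le zero_le_one] at hx
    linarith [hx.2]
  have h1 : IntervalIntegrable (fun x : ℝ => 1 / (2 - x) * -log x) volume 0 1 :=
    intervalIntegrable_mul_neg_log (ContinuousOn.div₀ (by fun_prop) (by fun_prop) hne)
  have h2 : IntervalIntegrable (fun x : ℝ => x / (1 + x ^ 2) * -log x) volume 0 1 :=
    intervalIntegrable_mul_neg_log
      (ContinuousOn.div₀ (by fun_prop) (by fun_prop) fun x _ => by positivity)
  have h3 : IntervalIntegrable (fun x : ℝ => 1 / (1 + x ^ 2) * -log x) volume 0 1 :=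
    intervalIntegrable_mul_neg_log
      (ContinuousOn.div₀ (by fun_prop) (by fun_prop) fun x _ => by positivity)
  have e : ∫ x in (0 : ℝ)..1, (1 - x) ^ 2 / (2 - x * (1 - x) ^ 2) * -log x =
      ∫ x in (0 : ℝ)..1, (1 / 5 * (1 / (2 - x) * -log x) - 4 / 5 * (x / (1 + x ^ 2) * -log x)
        + 2 / 5 * (1 / (1 + x ^ 2) * -log x)) := by
    refine intervalIntegral.integral_congr fun x hx => ?_
    have hx2 := hne x hx
    have hx1 : 1 + x ^ 2 ≠ 0 := by positivity
    simp only [show 2 - x * (1 - x) ^ 2 = (2 - x) * (1 + x ^ 2) by ring]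
    field_simp
    ring
  rw [e, intervalIntegral.integral_add ((h1.const_mul _).sub (h2.const_mul _)) (h3.const_mul _),
    intervalIntegral.integral_sub (h1.const_mul _) (h2.const_mul _)]
  simp only [intervalIntegral.integral_const_mul]
  rw [integral_neg_log_div_two_sub, integral_mul_neg_log_div_one_add_sq,
    integral_neg_log_div_one_add_sq]
  ring

theorem harmonicNum_div_choose_eq_integral (k : ℕ) :
    (harmonicNum (3 * (k + 1)) - harmonicNum (k + 1) + 1 / (k + 1 : ℝ)) /
        ((k + 1 : ℝ) * 2 ^ (k + 1) * (Nat.choose (3 * (k + 1)) (k + 1) : ℝ)) =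
      ∫ x in (0 : ℝ)..1, x ^ k * (1 - x) ^ (2 * k + 2) / 2 ^ (k + 1) * -log x := by
  have h : ∀ x : ℝ, x ^ k * (1 - x) ^ (2 * k + 2) / 2 ^ (k + 1) * -log x =
      1 / 2 ^ (k + 1) * (x ^ k * (1 - x) ^ (2 * k + 2) * -log x) := fun x => by ring
  simp only [h]
  rw [intervalIntegral.integral_const_mul, integral_pow_mul_one_sub_pow_mul_neg_log,
    Nat.cast_choose ℝ (show k + 1 ≤ 3 * (k + 1) by lia),
    show 3 * (k + 1) - (k + 1) = 2 * k + 2 by lia,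
    show k + (2 * k + 2) + 1 = 3 * (k + 1) by lia, harmonicNum_succ k, Nat.factorial_succ k]
  have := k.factorial_ne_zero
  have := (2 * k + 2).factorial_ne_zero
  have := (3 * (k + 1)).factorial_ne_zero
  push_cast
  field_simp
  ring

theorem integral_pow_mul_one_sub_pow_mul_neg_log_le_one (n m : ℕ) :
    ∫ x in (0 : ℝ)..1, x ^ m * (1 - x) ^ n * -log x ≤ 1 := by
  have h0 : ∫ x in (0 : ℝ)..1, x ^ 0 * -log x = 1 := by
    rw [integral_pow_mul_neg_log]; norm_num
  refine le_of_le_of_eq ?_ h0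
  refine intervalIntegral.integral_mono_on zero_le_one
    (intervalIntegrable_mul_neg_log (q := fun x => x ^ m * (1 - x) ^ n) (by fun_prop))
    (intervalIntegrable_mul_neg_log (q := fun x => x ^ 0) (by fun_prop)) fun x hx => ?_
  refine mul_le_mul_of_nonneg_right ?_ (by linarith [log_nonpos hx.1 hx.2])
  rw [pow_zero]
  exact mul_le_one₀ (pow_le_one₀ hx.1 hx.2) (pow_nonneg (by linarith [hx.2]) _)
    (pow_le_one₀ (by linarith [hx.2]) (by linarith [hx.1]))

theorem sun_inv3k_H3k_Hk :
    ∑' k : ℕ, (harmonicNum (3 * (k + 1)) - harmonicNum (k + 1) + 1 / (k + 1 : ℝ)) /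
        ((k + 1 : ℝ) * 2 ^ (k + 1) * (Nat.choose (3 * (k + 1)) (k + 1) : ℝ)) =
      2 * catalanG / 5 - Real.log 2 ^ 2 / 10 := by
  simp only [harmonicNum_div_choose_eq_integral]
  rw [← integral_neg_log_mul_generating_function]
  refine (hasSum_integral_mul_neg_log
    (p := fun k x => x ^ k * (1 - x) ^ (2 * k + 2) / 2 ^ (k + 1)) (by fun_prop) ?_ ?_).tsum_eq
  · have hnonneg : ∀ k : ℕ, ∀ x ∈ Icc (0 : ℝ) 1,
        0 ≤ x ^ k * (1 - x) ^ (2 * k + 2) / 2 ^ (k + 1) := fun k x hx => by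
      have := hx.1
      have : 0 ≤ 1 - x := by linarith [hx.2]
      positivity
    refine Summable.of_nonneg_of_le (fun k => ?_) (fun k => ?_) summable_geometric_two
    · refine intervalIntegral.integral_nonneg zero_le_one fun x hx => ?_
      exact mul_nonneg (abs_nonneg _) (by linarith [log_nonpos hx.1 hx.2])
    · have e : ∫ x in (0 : ℝ)..1, |x ^ k * (1 - x) ^ (2 * k + 2) / 2 ^ (k + 1)| * -log x =
          1 / 2 ^ (k + 1) * ∫ x in (0 : ℝ)..1, x ^ k * (1 - x) ^ (2 * k + 2) * -log x := by
        rw [← intervalIntegral.integral_const_mul]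
        refine intervalIntegral.integral_congr fun x hx => ?_
        rw [uIcc_of_le zero_le_one] at hx
        simp only [abs_of_nonneg (hnonneg k x hx)]
        ring
      rw [e]
      calc _ ≤ 1 / 2 ^ (k + 1) * (1 : ℝ) := by
            gcongr
            exact integral_pow_mul_one_sub_pow_mul_neg_log_le_one _ _
        _ ≤ (1 / 2) ^ k := by
            rw [pow_succ, one_div_pow, mul_one]
            gcongr
            exact le_mul_of_one_le_right (by positivity) one_le_two
  · intro x hx
    have hx0 := hx.1
    have h1 : 0 < 1 - x := by linarith [hx.2]
    have hle : x * (1 - x) ^ 2 ≤ 1 :=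
      mul_le_one₀ hx.2.le (by positivity) (pow_le_one₀ h1.le (by linarith))
    have hg := (hasSum_geometric_of_lt_one (r := x * (1 - x) ^ 2 / 2) (by positivity)
      (by linarith)).mul_right ((1 - x) ^ 2 / 2)
    refine hasSum_of_hasSum_of_eq hg (fun k => ?_) ?_
    · rw [div_pow, mul_pow, ← pow_mul, pow_add, pow_succ 2 k]
      field_simp
    · have : 2 - x * (1 - x) ^ 2 ≠ 0 := by linarith
      have : 1 - x * (1 - x) ^ 2 / 2 ≠ 0 := by linarith
      field_simp
end

section
/- For every real φ with 0 < φ < π/3, the convergent series ∑_{k=0}^∞ (C(3k,k)/27^k)·(4·cos²(3φ/2))^k·(3H_{3k} − 2H_{2k} − H_k − 3·log 3) equals −(2√3/sin(3φ/2))·[ cos(φ/2)·log( 2·cos(φ/2 − π/3) ) + cos(φ/2 − π/3)·log( 2·cos(φ/2) ) ]. -/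
open scoped BigOperators
open Real

/-- Coefficient sequences of at most polynomial growth. -/
def PolyGrowth (a : ℕ → ℝ) : Prop :=
  ∃ (C : ℝ) (m : ℕ), ∀ k : ℕ, |a k| ≤ C * ((k : ℝ) + 1) ^ m

/-- The coefficients of the derivative of the power series with coefficients `a`. -/
def derivCoeff (a : ℕ → ℝ) (k : ℕ) : ℝ := ((k : ℝ) + 1) * a (k + 1)

/-- The sum of the power series with coefficients `a`. -/
noncomputable def powerSum (a : ℕ → ℝ) (y : ℝ) : ℝ := ∑' k : ℕ, a k * y ^ k

lemma PolyGrowth.summable {a : ℕ → ℝ} (ha : PolyGrowth a) {y : ℝ} (hy : |y| < 1) :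
    Summable fun k : ℕ => a k * y ^ k := by
  obtain ⟨C, m, h⟩ := ha
  have hC : 0 ≤ C := by
    have := (abs_nonneg _).trans (h 0)
    simpa using this
  have hy' : ‖|y|‖ < 1 := by simpa using hy
  have h1 := summable_pow_mul_geometric_of_norm_lt_one m hy'
  have h2 := summable_geometric_of_norm_lt_one hy'
  refine Summable.of_norm_bounded (((h1.add h2).mul_left (C * 2 ^ (m - 1)))) fun k => ?_
  rw [norm_mul, norm_pow, Real.norm_eq_abs, Real.norm_eq_abs]
  have h3 : ((k : ℝ) + 1) ^ m ≤ 2 ^ (m - 1) * ((k : ℝ) ^ m + 1 ^ m) :=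
    add_pow_le (by positivity) zero_le_one m
  calc |a k| * |y| ^ k ≤ (C * (2 ^ (m - 1) * ((k : ℝ) ^ m + 1 ^ m))) * |y| ^ k := by
        gcongr
        exact (h k).trans (by gcongr)
    _ = _ := by rw [one_pow]; ring

lemma PolyGrowth.hasSum {a : ℕ → ℝ} (ha : PolyGrowth a) {y : ℝ} (hy : |y| < 1) :
    HasSum (fun k : ℕ => a k * y ^ k) (powerSum a y) :=
  (ha.summable hy).hasSum

lemma PolyGrowth.derivCoeff {a : ℕ → ℝ} (ha : PolyGrowth a) : PolyGrowth (derivCoeff a) := by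
  obtain ⟨C, m, h⟩ := ha
  have hC : 0 ≤ C := by
    have := (abs_nonneg _).trans (h 0)
    simpa using this
  refine ⟨C * 2 ^ m, m + 1, fun k => ?_⟩
  have h1 := h (k + 1)
  have hk : (0 : ℝ) < (k : ℝ) + 1 := by positivity
  rw [_root_.derivCoeff, abs_mul, abs_of_pos hk]
  calc ((k : ℝ) + 1) * |a (k + 1)| ≤ ((k : ℝ) + 1) * (C * (2 * ((k : ℝ) + 1)) ^ m) := by
        gcongr
        refine h1.trans ?_
        push_cast
        gcongr
        linarith
    _ = _ := by rw [mul_pow]; ring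

lemma PolyGrowth.tail {a : ℕ → ℝ} (ha : PolyGrowth a) : PolyGrowth fun k => a (k + 1) := by
  obtain ⟨C, m, h⟩ := ha.derivCoeff
  refine ⟨C, m, fun k => le_trans ?_ (h k)⟩
  rw [_root_.derivCoeff, abs_mul, abs_of_pos (by positivity : (0 : ℝ) < (k : ℝ) + 1)]
  exact le_mul_of_one_le_left (abs_nonneg _) (by linarith [(Nat.cast_nonneg k : (0 : ℝ) ≤ k)])

lemma PolyGrowth.natCast_mul {a : ℕ → ℝ} (ha : PolyGrowth a) :
    PolyGrowth fun k : ℕ => (k : ℝ) * a k := by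
  obtain ⟨C, m, h⟩ := ha
  refine ⟨C, m + 1, fun k => ?_⟩
  have hk : (0 : ℝ) ≤ k := Nat.cast_nonneg k
  rw [abs_mul, abs_of_nonneg hk]
  calc (k : ℝ) * |a k| ≤ ((k : ℝ) + 1) * (C * ((k : ℝ) + 1) ^ m) :=
        mul_le_mul (by linarith) (h k) (abs_nonneg _) (by linarith)
    _ = _ := by ring

lemma powerSum_zero (a : ℕ → ℝ) : powerSum a 0 = a 0 := by
  rw [powerSum, tsum_eq_single 0]
  · simp
  · intro k hk
    simp [hk]

lemma PolyGrowth.powerSum_eq {a : ℕ → ℝ} (ha : PolyGrowth a) {y : ℝ} (hy : |y| < 1) :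
    powerSum a y = a 0 + y * powerSum (fun k => a (k + 1)) y := by
  rw [powerSum, (ha.summable hy).tsum_eq_zero_add, powerSum, ← tsum_mul_left]
  congr 1
  · simp
  · exact tsum_congr fun k => by ring

lemma PolyGrowth.hasSum_natCast_mul {a : ℕ → ℝ} (ha : PolyGrowth a) {y : ℝ} (hy : |y| < 1) :
    HasSum (fun k : ℕ => (k : ℝ) * a k * y ^ k) (y * powerSum (_root_.derivCoeff a) y) := by
  have h := ha.natCast_mul.hasSum hy
  rw [ha.natCast_mul.powerSum_eq hy] at h
  simpa [show (fun k : ℕ => ((k : ℝ) + 1) * a (k + 1)) = _root_.derivCoeff a from rfl] using h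

lemma PolyGrowth.hasDerivAt {a : ℕ → ℝ} (ha : PolyGrowth a) {y : ℝ} (hy : |y| < 1) :
    HasDerivAt (powerSum a) (powerSum (_root_.derivCoeff a) y) y := by
  obtain ⟨r, hr, hr1⟩ := exists_between hy
  have hr0 : 0 < r := (abs_nonneg y).trans_lt hr
  have hrabs : |r| < 1 := by rwa [abs_of_pos hr0]
  have hb : Summable fun k : ℕ => (k : ℝ) * |a k| * r ^ (k - 1) := by
    rw [← summable_nat_add_iff 1]
    have := (ha.derivCoeff.summable hrabs).norm
    refine this.congr fun k => ?_
    rw [norm_mul, norm_pow, Real.norm_eq_abs, Real.norm_eq_abs, _root_.derivCoeff, abs_mul,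
      abs_of_pos hr0, abs_of_pos (by positivity : (0 : ℝ) < (k : ℝ) + 1)]
    push_cast
    simp
  have key := hasDerivAt_tsum_of_isPreconnected (𝕜 := ℝ) (F := ℝ)
    (g := fun (k : ℕ) x => a k * x ^ k)
    (g' := fun (k : ℕ) x => a k * ((k : ℝ) * x ^ (k - 1))) (t := Metric.ball 0 r)
    (y₀ := y) (y := y) hb Metric.isOpen_ball (convex_ball 0 r).isPreconnected
    (fun k x _ => (hasDerivAt_pow k x).const_mul (a k))
    (fun k x hx => by
      have hx' : |x| ≤ r := by simpa using (Metric.mem_ball.1 hx).le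
      rw [norm_mul, norm_mul, norm_pow, Real.norm_eq_abs, Real.norm_eq_abs, Real.norm_eq_abs,
        Nat.abs_cast]
      calc |a k| * ((k : ℝ) * |x| ^ (k - 1)) = (k : ℝ) * |a k| * |x| ^ (k - 1) := by ring
        _ ≤ _ := by gcongr)
    (by simpa using hr) (ha.summable hy) (by simpa using hr)
  have hs : ∑' k : ℕ, a k * ((k : ℝ) * y ^ (k - 1)) = powerSum (_root_.derivCoeff a) y := by
    have h0 := (ha.derivCoeff.hasSum hy)
    have h1 : HasSum (fun k : ℕ => a (k + 1) * (((k + 1 : ℕ) : ℝ) * y ^ (k + 1 - 1)))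
        (powerSum (_root_.derivCoeff a) y) := by
      convert h0 using 2 with k
      simp [_root_.derivCoeff]
      ring
    have h2 := HasSum.zero_add (f := fun k : ℕ => a k * ((k : ℝ) * y ^ (k - 1))) h1
    simpa using h2.tsum_eq
  rw [hs] at key
  exact key

lemma hasSum_of_eq {f g : ℕ → ℝ} {S : ℝ} (hf : HasSum f S) (h : ∀ k, g k = f k) :
    HasSum g S := by
  rwa [funext h]

/-- A recurrence with hypergeometric parameters `1/3, 2/3; 1/2` turns into a differential
equation for the generating function. -/
lemma powerSum_hypergeometric {a b : ℕ → ℝ} (ha : PolyGrowth a)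
    (hrec : ∀ k : ℕ, ((k : ℝ) + 1 / 2) * (k + 1) * a (k + 1) - (k + 1 / 3) * (k + 2 / 3) * a k
      = b k) {y S : ℝ} (hy : |y| < 1) (hS : HasSum (fun k : ℕ => b k * y ^ k) S) :
    y * (1 - y) * powerSum (derivCoeff (derivCoeff a)) y
      + (1 / 2 - 2 * y) * powerSum (derivCoeff a) y - 2 / 9 * powerSum a y = S := by
  have h0 := ha.hasSum hy
  have h1 := ha.derivCoeff.hasSum hy
  have h2 := ha.derivCoeff.hasSum_natCast_mul hy
  have h3 := ha.hasSum_natCast_mul hy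
  have h4 := ha.natCast_mul.hasSum_natCast_mul hy
  have h5 : powerSum (derivCoeff fun k : ℕ => (k : ℝ) * a k) y
      = y * powerSum (derivCoeff (derivCoeff a)) y + powerSum (derivCoeff a) y := by
    refine (ha.natCast_mul.derivCoeff.hasSum hy).unique ?_
    convert h2.add h1 using 2 with k
    simp only [derivCoeff]
    push_cast
    ring
  rw [h5] at h4
  have h6 := (h2.add (h1.mul_left (1 / 2))).sub ((h4.add h3).add (h0.mul_left (2 / 9)))
  have h7 := hS.unique (hasSum_of_eq h6 fun k => by
    rw [← hrec k]
    simp only [derivCoeff]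
    ring)
  rw [h7]
  ring

/-- The first derivative of `θ ↦ cos θ * powerSum a (sin θ ^ 2)`. -/
noncomputable def trigSumDeriv (a : ℕ → ℝ) (θ : ℝ) : ℝ :=
  -sin θ * powerSum a (sin θ ^ 2) + 2 * sin θ * cos θ ^ 2 * powerSum (derivCoeff a) (sin θ ^ 2)

lemma abs_sin_sq_lt_one {θ : ℝ} (hθ : 0 < cos θ) : |sin θ ^ 2| < 1 := by
  rw [abs_of_nonneg (sq_nonneg _), sin_sq]
  have := pow_pos hθ 2
  linarith

lemma hasDerivAt_powerSum_sin_sq {a : ℕ → ℝ} (ha : PolyGrowth a) {θ : ℝ} (hθ : 0 < cos θ) :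
    HasDerivAt (fun x => powerSum a (sin x ^ 2))
      (powerSum (derivCoeff a) (sin θ ^ 2) * (2 * sin θ * cos θ)) θ := by
  have h1 : HasDerivAt (fun x => sin x ^ 2) (2 * sin θ * cos θ) θ := by
    exact ((hasDerivAt_sin θ).pow 2).congr_deriv (by norm_num)
  exact (ha.hasDerivAt (abs_sin_sq_lt_one hθ)).comp θ h1

lemma hasDerivAt_trigSum {a : ℕ → ℝ} (ha : PolyGrowth a) {θ : ℝ} (hθ : 0 < cos θ) :
    HasDerivAt (fun x => cos x * powerSum a (sin x ^ 2)) (trigSumDeriv a θ) θ := by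
  refine ((hasDerivAt_cos θ).mul (hasDerivAt_powerSum_sin_sq ha hθ)).congr_deriv ?_
  rw [trigSumDeriv]
  ring

lemma hasDerivAt_trigSumDeriv {a b : ℕ → ℝ} (ha : PolyGrowth a)
    (hrec : ∀ k : ℕ, ((k : ℝ) + 1 / 2) * (k + 1) * a (k + 1) - (k + 1 / 3) * (k + 2 / 3) * a k
      = b k) {θ S : ℝ} (hθ : 0 < cos θ)
    (hS : HasSum (fun k : ℕ => b k * (sin θ ^ 2) ^ k) S) :
    HasDerivAt (trigSumDeriv a)
      (-(cos θ * powerSum a (sin θ ^ 2)) / 9 + 4 * cos θ * S) θ := by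
  have hode := powerSum_hypergeometric ha hrec (abs_sin_sq_lt_one hθ) hS
  have h1 := (hasDerivAt_sin θ).neg.mul (hasDerivAt_powerSum_sin_sq ha hθ)
  have h2 := (((hasDerivAt_sin θ).const_mul 2).mul ((hasDerivAt_cos θ).pow 2)).mul
    (hasDerivAt_powerSum_sin_sq ha.derivCoeff hθ)
  refine (h1.add h2).congr_deriv ?_
  rw [← hode]
  simp only [Pi.mul_apply, Pi.pow_apply, Pi.neg_apply]
  have hc : cos θ ^ 2 = 1 - sin θ ^ 2 := cos_sq' θ
  generalize powerSum (derivCoeff (derivCoeff a)) (sin θ ^ 2) = P2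
  generalize powerSum (derivCoeff a) (sin θ ^ 2) = P1
  generalize powerSum a (sin θ ^ 2) = P0
  push_cast
  linear_combination (2 * cos θ * P1 + 4 * cos θ * sin θ ^ 2 * P2) * hc

/-- Uniqueness for the harmonic oscillator `δ'' = -δ / 9` with vanishing initial data. -/
lemma oscillator_eq_zero {δ δ₁ δ₂ : ℝ → ℝ} {b : ℝ} (hb : 0 < b)
    (h1 : ∀ x ∈ Set.Icc 0 b, HasDerivAt δ (δ₁ x) x)
    (h2 : ∀ x ∈ Set.Icc 0 b, HasDerivAt δ₁ (δ₂ x) x)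
    (h3 : ∀ x ∈ Set.Ioo 0 b, δ₂ x = -δ x / 9) (h4 : δ 0 = 0) (h5 : δ₁ 0 = 0) : δ b = 0 := by
  have hd : ∀ x ∈ Set.Icc 0 b, HasDerivAt (fun x => δ₁ x ^ 2 + δ x ^ 2 / 9)
      (2 * δ₁ x * δ₂ x + 2 * δ x * δ₁ x / 9) x := fun x hx => by
    exact (((h2 x hx).pow 2).add (((h1 x hx).pow 2).div_const 9)).congr_deriv (by norm_num)
  obtain ⟨c, hc, hc'⟩ := exists_hasDerivAt_eq_slope _ _ hb
    (fun x hx => (hd x hx).continuousAt.continuousWithinAt)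
    (fun x hx => hd x (Set.Ioo_subset_Icc_self hx))
  rw [h3 c hc, eq_div_iff (by linarith), h4, h5] at hc'
  have : δ₁ b ^ 2 + δ b ^ 2 / 9 = 0 := by linear_combination -hc'
  have h6 : δ b ^ 2 = 0 := by nlinarith [sq_nonneg (δ₁ b), sq_nonneg (δ b)]
  exact pow_eq_zero_iff (two_ne_zero) |>.1 h6

/-- The coefficients of `₂F₁(1/3, 2/3; 1/2; y)`. -/
noncomputable def hyperCoeff (k : ℕ) : ℝ := (Nat.choose (3 * k) k : ℝ) / 27 ^ k * 4 ^ k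

lemma hyperCoeff_succ (k : ℕ) :
    ((k : ℝ) + 1 / 2) * (k + 1) * hyperCoeff (k + 1)
      - (k + 1 / 3) * (k + 2 / 3) * hyperCoeff k = 0 := by
  have h1 := Nat.choose_mul_factorial_mul_factorial (n := 3 * k) (k := k) (by lia)
  have h2 := Nat.choose_mul_factorial_mul_factorial (n := 3 * (k + 1)) (k := k + 1) (by lia)
  rw [show 3 * k - k = 2 * k by lia] at h1
  rw [show 3 * (k + 1) - (k + 1) = 2 * k + 1 + 1 by lia,
    show 3 * (k + 1) = 3 * k + 1 + 1 + 1 by lia] at h2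
  simp only [Nat.factorial_succ] at h2
  rw [← h1] at h2
  have hk : (k.factorial : ℝ) * (2 * k).factorial ≠ 0 := by positivity
  have h3 : ((3 * k + 1 + 1 + 1).choose (k + 1) : ℝ) * ((k + 1) * (2 * k + 2) * (2 * k + 1))
      = (3 * k + 3) * (3 * k + 2) * (3 * k + 1) * (3 * k).choose k := by
    apply mul_right_cancel₀ hk
    have := congrArg (Nat.cast (R := ℝ)) h2
    push_cast at this
    linear_combination this
  have h4 : ((3 * k + 1 + 1 + 1).choose (k + 1) : ℝ) * ((2 * k + 2) * (2 * k + 1))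
      = 3 * (3 * k + 2) * (3 * k + 1) * (3 * k).choose k := by
    apply mul_right_cancel₀ (by positivity : (k : ℝ) + 1 ≠ 0)
    linear_combination h3
  rw [hyperCoeff, hyperCoeff, show 3 * (k + 1) = 3 * k + 1 + 1 + 1 by lia, pow_succ, pow_succ]
  linear_combination (4 ^ k / 27 ^ k / 27) * h4

lemma hyperCoeff_nonneg (k : ℕ) : 0 ≤ hyperCoeff k := by
  rw [hyperCoeff]
  positivity

lemma hyperCoeff_le_one (k : ℕ) : hyperCoeff k ≤ 1 := by
  induction k with
  | zero => simp [hyperCoeff]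
  | succ k ih =>
    refine le_trans ?_ ih
    have h := hyperCoeff_succ k
    have h0 := hyperCoeff_nonneg k
    have hk : (0 : ℝ) ≤ k := Nat.cast_nonneg k
    refine le_of_mul_le_mul_left (a := ((k : ℝ) + 1 / 2) * (k + 1)) ?_ (by positivity)
    have : 0 ≤ ((k : ℝ) / 2 + 5 / 18) * hyperCoeff k := by positivity
    linarith

lemma polyGrowth_hyperCoeff : PolyGrowth hyperCoeff :=
  ⟨1, 0, fun k => by
    rw [abs_of_nonneg (hyperCoeff_nonneg k)]
    simpa using hyperCoeff_le_one k⟩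

/-- The harmonic factor `3 H_{3k} - 2 H_{2k} - H_k - 3 log 3`. -/
noncomputable def harmonicFactor (k : ℕ) : ℝ :=
  3 * harmonicNum (3 * k) - 2 * harmonicNum (2 * k) - harmonicNum k - 3 * Real.log 3

lemma harmonicFactor_succ (k : ℕ) :
    harmonicFactor (k + 1) = harmonicFactor k +
      (1 / (k + 1 / 3) + 1 / (k + 2 / 3) - 1 / (k + 1 / 2) - 1 / (k + 1)) := by
  simp only [harmonicFactor, harmonicNum, show 3 * (k + 1) = 3 * k + 1 + 1 + 1 by lia,
    show 2 * (k + 1) = 2 * k + 1 + 1 by lia, Finset.sum_range_succ]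
  push_cast
  rw [show (3 * (k : ℝ) + 1 + 1) = 3 * k + 2 by ring,
    show (3 * (k : ℝ) + 2 + 1) = 3 * (k + 1) by ring,
    show (2 * (k : ℝ) + 1 + 1) = 2 * (k + 1) by ring,
    show ((k : ℝ) + 1 / 3) = (3 * k + 1) / 3 by ring,
    show ((k : ℝ) + 2 / 3) = (3 * k + 2) / 3 by ring,
    show ((k : ℝ) + 1 / 2) = (2 * k + 1) / 2 by ring]
  simp only [one_div_div]
  rw [show (1 : ℝ) / (3 * (k + 1)) = 1 / 3 * (1 / (k + 1)) by field_simp,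
    show (1 : ℝ) / (2 * (k + 1)) = 1 / 2 * (1 / (k + 1)) by field_simp]
  ring

lemma abs_harmonicFactor_le (k : ℕ) : |harmonicFactor k| ≤ |3 * Real.log 3| + 8 * k := by
  induction k with
  | zero => simp [harmonicFactor, harmonicNum]
  | succ k ih =>
    have hk : (0 : ℝ) ≤ k := Nat.cast_nonneg k
    have bound : ∀ c : ℝ, 1 / 3 ≤ c → 0 ≤ 1 / ((k : ℝ) + c) ∧ 1 / ((k : ℝ) + c) ≤ 3 :=
      fun c hc => ⟨by positivity, by rw [div_le_iff₀ (by linarith)]; linarith⟩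
    have b1 := bound (1 / 3) (by norm_num)
    have b2 := bound (2 / 3) (by norm_num)
    have b3 := bound (1 / 2) (by norm_num)
    have b4 := bound 1 (by norm_num)
    rw [harmonicFactor_succ]
    refine (abs_add_le _ _).trans ?_
    have : |1 / ((k : ℝ) + 1 / 3) + 1 / (k + 2 / 3) - 1 / (k + 1 / 2) - 1 / (k + 1)| ≤ 8 := by
      rw [abs_le]
      constructor <;> linarith
    push_cast
    linarith

/-- The coefficients of the series weighted by the harmonic factor. -/
noncomputable def weightedCoeff (k : ℕ) : ℝ := hyperCoeff k * harmonicFactor k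

lemma polyGrowth_weightedCoeff : PolyGrowth weightedCoeff := by
  refine ⟨|3 * Real.log 3| + 8, 1, fun k => ?_⟩
  rw [weightedCoeff, abs_mul, abs_of_nonneg (hyperCoeff_nonneg k)]
  have hk : (0 : ℝ) ≤ k := Nat.cast_nonneg k
  calc hyperCoeff k * |harmonicFactor k| ≤ 1 * |harmonicFactor k| := by
        gcongr
        exact hyperCoeff_le_one k
    _ ≤ |3 * Real.log 3| + 8 * k := by rw [one_mul]; exact abs_harmonicFactor_le k
    _ ≤ _ := by nlinarith [abs_nonneg (3 * Real.log 3)]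

lemma weightedCoeff_succ (k : ℕ) :
    ((k : ℝ) + 1 / 2) * (k + 1) * weightedCoeff (k + 1)
      - (k + 1 / 3) * (k + 2 / 3) * weightedCoeff k
      = 2 * (k * hyperCoeff k) + hyperCoeff k - 2 * derivCoeff hyperCoeff k
        + 1 / 2 * hyperCoeff (k + 1) := by
  have h := hyperCoeff_succ k
  rw [weightedCoeff, weightedCoeff, harmonicFactor_succ, derivCoeff]
  set u := hyperCoeff k
  set v := hyperCoeff (k + 1)
  have e3 : ((k : ℝ) + 1 / 2) * (1 / (k + 1 / 2)) = 1 := mul_one_div_cancel (by positivity)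
  have e4 : ((k : ℝ) + 1) * (1 / (k + 1)) = 1 := mul_one_div_cancel (by positivity)
  have e1 : ((k : ℝ) + 1 / 3) * (1 / (k + 1 / 3)) = 1 := mul_one_div_cancel (by positivity)
  have e2 : ((k : ℝ) + 2 / 3) * (1 / (k + 2 / 3)) = 1 := mul_one_div_cancel (by positivity)
  generalize (1 : ℝ) / (k + 1 / 3) = i1 at *
  generalize (1 : ℝ) / (k + 2 / 3) = i2 at *
  generalize (1 : ℝ) / (k + 1 / 2) = i3 at *
  generalize (1 : ℝ) / (k + 1) = i4 at *
  linear_combination (harmonicFactor k + i1 + i2) * h + (k + 2 / 3) * u * e1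
    + (k + 1 / 3) * u * e2 - (k + 1) * v * e3 - (k + 1 / 2) * v * e4

lemma hasDerivAt_cos_div_three (θ : ℝ) :
    HasDerivAt (fun x => cos (x / 3)) (-sin (θ / 3) / 3) θ := by
  refine ((hasDerivAt_id' θ).div_const 3).cos.congr_deriv ?_
  ring

lemma hasDerivAt_sin_div_three (θ : ℝ) :
    HasDerivAt (fun x => sin (x / 3)) (cos (θ / 3) / 3) θ := by
  refine ((hasDerivAt_id' θ).div_const 3).sin.congr_deriv ?_
  ring

lemma cos_mul_powerSum_hyperCoeff {θ : ℝ} (h0 : 0 < θ) (h1 : θ < π / 2) :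
    cos θ * powerSum hyperCoeff (sin θ ^ 2) = cos (θ / 3) := by
  have hcos : ∀ x ∈ Set.Icc 0 θ, 0 < cos x := fun x hx =>
    cos_pos_of_mem_Ioo ⟨by linarith [hx.1, pi_pos], by linarith [hx.2]⟩
  have key := oscillator_eq_zero
    (δ := fun x => cos x * powerSum hyperCoeff (sin x ^ 2) - cos (x / 3))
    (δ₁ := fun x => trigSumDeriv hyperCoeff x - -sin (x / 3) / 3) h0
    (fun x hx => (hasDerivAt_trigSum polyGrowth_hyperCoeff (hcos x hx)).sub
      (hasDerivAt_cos_div_three x))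
    (fun x hx => (hasDerivAt_trigSumDeriv (b := fun _ => 0) polyGrowth_hyperCoeff hyperCoeff_succ
      (hcos x hx) (S := 0) (by simp)).sub
      ((hasDerivAt_sin_div_three x).neg.div_const 3))
    (fun x _ => by ring) (by simp [powerSum_zero, hyperCoeff]) (by simp [trigSumDeriv])
  exact sub_eq_zero.1 key

lemma trigSumDeriv_hyperCoeff {θ : ℝ} (h0 : 0 < θ) (h1 : θ < π / 2) :
    trigSumDeriv hyperCoeff θ = -sin (θ / 3) / 3 := by
  have hcos : 0 < cos θ := cos_pos_of_mem_Ioo ⟨by linarith [pi_pos], h1⟩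
  refine (hasDerivAt_trigSum polyGrowth_hyperCoeff hcos).unique
    ((hasDerivAt_cos_div_three θ).congr_of_eventuallyEq ?_)
  filter_upwards [Ioo_mem_nhds h0 h1] with x hx
  exact cos_mul_powerSum_hyperCoeff hx.1 hx.2

/-- The inhomogeneous term of the differential equation for the weighted series. -/
noncomputable def sourceTerm (y : ℝ) : ℝ :=
  2 * (y * powerSum (derivCoeff hyperCoeff) y) + powerSum hyperCoeff y
    - 2 * powerSum (derivCoeff hyperCoeff) y + 1 / 2 * powerSum (fun k => hyperCoeff (k + 1)) y

lemma hasSum_sourceTerm {y : ℝ} (hy : |y| < 1) :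
    HasSum (fun k : ℕ => (2 * (k * hyperCoeff k) + hyperCoeff k - 2 * derivCoeff hyperCoeff k
        + 1 / 2 * hyperCoeff (k + 1)) * y ^ k) (sourceTerm y) := by
  have hu := polyGrowth_hyperCoeff
  refine hasSum_of_eq (((((hu.hasSum_natCast_mul hy).mul_left 2).add (hu.hasSum hy)).sub
    ((hu.derivCoeff.hasSum hy).mul_left 2)).add ((hu.tail.hasSum hy).mul_left (1 / 2))) fun k => ?_
  ring

lemma four_mul_cos_mul_sourceTerm {θ : ℝ} (h0 : 0 < θ) (h1 : θ < π / 2) :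
    4 * cos θ * sourceTerm (sin θ ^ 2) =
      cos (θ / 3) * (8 * cos (θ / 3) ^ 4 - 8 * cos (θ / 3) ^ 2 + 9 / 2)
        / (6 * (cos (θ / 3) ^ 2 - 1 / 4) ^ 2) := by
  have hcos : 0 < cos θ := cos_pos_of_mem_Ioo ⟨by linarith [pi_pos], h1⟩
  have hsin : 0 < sin θ := sin_pos_of_pos_of_lt_pi h0 (by linarith [pi_pos])
  have hF := cos_mul_powerSum_hyperCoeff h0 h1
  have hF' := trigSumDeriv_hyperCoeff h0 h1
  have hT := polyGrowth_hyperCoeff.powerSum_eq (abs_sin_sq_lt_one hcos)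
  rw [show hyperCoeff 0 = 1 by simp [hyperCoeff]] at hT
  have hs3 : sin θ = 4 * sin (θ / 3) * (cos (θ / 3) ^ 2 - 1 / 4) := by
    have h := sin_three_mul (θ / 3)
    rw [show 3 * (θ / 3) = θ by ring] at h
    rw [h]
    linear_combination (-4 * sin (θ / 3)) * sin_sq_add_cos_sq (θ / 3)
  have hc3 : cos θ = 4 * cos (θ / 3) ^ 3 - 3 * cos (θ / 3) := by
    have h := cos_three_mul (θ / 3)
    rwa [show 3 * (θ / 3) = θ by ring] at h
  have hX : cos (θ / 3) ^ 2 - 1 / 4 ≠ 0 := by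
    intro h
    rw [h, mul_zero] at hs3
    exact hsin.ne' hs3
  have hq : sin (θ / 3) ≠ 0 := by
    intro h
    rw [h] at hs3
    simp at hs3
    exact hsin.ne' hs3
  rw [trigSumDeriv] at hF'
  rw [sourceTerm]
  generalize powerSum (fun k => hyperCoeff (k + 1)) (sin θ ^ 2) = T at *
  generalize powerSum (derivCoeff hyperCoeff) (sin θ ^ 2) = F1 at *
  generalize powerSum hyperCoeff (sin θ ^ 2) = F at *
  have hsc := sin_sq_add_cos_sq θ
  have hpq := sin_sq_add_cos_sq (θ / 3)
  have main : sin θ ^ 2 * (4 * cos θ * (2 * (sin θ ^ 2 * F1) + F - 2 * F1 + 1 / 2 * T)) =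
      4 / 3 * cos θ * sin θ * sin (θ / 3) + 2 * (cos (θ / 3) - cos θ) := by
    linear_combination (-4 * cos θ * sin θ) * hF' + 2 * hF - 2 * cos θ * hT
      + (8 * cos θ * sin θ ^ 2 * F1) * hsc
  apply mul_left_cancel₀ (pow_ne_zero 2 hsin.ne')
  rw [main, hs3, hc3]
  generalize cos (θ / 3) = p at *
  generalize sin (θ / 3) = q at *
  have hN : ∀ N X : ℝ, X ≠ 0 → (4 * q * X) ^ 2 * (N / (6 * X ^ 2)) = 8 / 3 * q ^ 2 * N := by
    intro N X h
    field_simp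
    ring
  rw [hN _ _ hX]
  linear_combination (16 / 3 * (p ^ 2 - 1 / 4) * (4 * p ^ 3 - 3 * p)
    - 8 / 3 * (p * (8 * p ^ 4 - 8 * p ^ 2 + 9 / 2))) * hpq

/-- The closed form, as a function of `θ = π / 2 - 3 φ / 2`. -/
noncomputable def closedForm (θ : ℝ) : ℝ :=
  -2 * √3 * (cos (π / 6 - θ / 3) * Real.log (2 * cos (π / 6 + θ / 3))
    + cos (π / 6 + θ / 3) * Real.log (2 * cos (π / 6 - θ / 3)))

/-- The derivative of `closedForm`. -/
noncomputable def closedFormDeriv (θ : ℝ) : ℝ :=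
  -2 * √3 / 3 * (sin (π / 6 - θ / 3) * Real.log (2 * cos (π / 6 + θ / 3))
    - cos (π / 6 - θ / 3) * sin (π / 6 + θ / 3) / cos (π / 6 + θ / 3)
    - sin (π / 6 + θ / 3) * Real.log (2 * cos (π / 6 - θ / 3))
    + cos (π / 6 + θ / 3) * sin (π / 6 - θ / 3) / cos (π / 6 - θ / 3))

lemma hasDerivAt_sixth_sub (θ : ℝ) : HasDerivAt (fun x => π / 6 - x / 3) (-(1 / 3)) θ :=
  ((hasDerivAt_id θ).div_const 3).const_sub (π / 6)

lemma hasDerivAt_sixth_add (θ : ℝ) : HasDerivAt (fun x => π / 6 + x / 3) (1 / 3) θ :=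
  ((hasDerivAt_id θ).div_const 3).const_add (π / 6)

lemma hasDerivAt_closedForm {θ : ℝ} (hA : 0 < cos (π / 6 - θ / 3))
    (hB : 0 < cos (π / 6 + θ / 3)) : HasDerivAt closedForm (closedFormDeriv θ) θ := by
  have dA := (hasDerivAt_sixth_sub θ).cos
  have dB := (hasDerivAt_sixth_add θ).cos
  have lA := (dA.const_mul 2).log (by positivity)
  have lB := (dB.const_mul 2).log (by positivity)
  refine (((dA.mul lB).add (dB.mul lA)).const_mul (-2 * √3)).congr_deriv ?_
  rw [closedFormDeriv]
  field_simp
  ring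

lemma hasDerivAt_closedFormDeriv {θ : ℝ} (hA : 0 < cos (π / 6 - θ / 3))
    (hB : 0 < cos (π / 6 + θ / 3)) :
    HasDerivAt closedFormDeriv (-closedForm θ / 9 +
      cos (θ / 3) * (8 * cos (θ / 3) ^ 4 - 8 * cos (θ / 3) ^ 2 + 9 / 2)
        / (6 * (cos (θ / 3) ^ 2 - 1 / 4) ^ 2)) θ := by
  have dA := (hasDerivAt_sixth_sub θ).cos
  have dB := (hasDerivAt_sixth_add θ).cos
  have sA := (hasDerivAt_sixth_sub θ).sin
  have sB := (hasDerivAt_sixth_add θ).sin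
  have lA := (dA.const_mul 2).log (by positivity)
  have lB := (dB.const_mul 2).log (by positivity)
  refine (((((sA.mul lB).sub ((dA.mul sB).div dB hB.ne')).sub (sB.mul lA)).add
    ((dB.mul sA).div dA hA.ne')).const_mul (-2 * √3 / 3)).congr_deriv ?_
  have h3 : √3 ^ 2 = 3 := Real.sq_sqrt (by norm_num)
  have eA : cos (π / 6 - θ / 3) = √3 / 2 * cos (θ / 3) + 1 / 2 * sin (θ / 3) := by
    rw [cos_sub, cos_pi_div_six, sin_pi_div_six]
  have eB : cos (π / 6 + θ / 3) = √3 / 2 * cos (θ / 3) - 1 / 2 * sin (θ / 3) := by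
    rw [cos_add, cos_pi_div_six, sin_pi_div_six]
  have eA' : sin (π / 6 - θ / 3) = 1 / 2 * cos (θ / 3) - √3 / 2 * sin (θ / 3) := by
    rw [sin_sub, cos_pi_div_six, sin_pi_div_six]
  have eB' : sin (π / 6 + θ / 3) = 1 / 2 * cos (θ / 3) + √3 / 2 * sin (θ / 3) := by
    rw [sin_add, cos_pi_div_six, sin_pi_div_six]
  have hpq := sin_sq_add_cos_sq (θ / 3)
  have hX : cos (θ / 3) ^ 2 - 1 / 4 = cos (π / 6 - θ / 3) * cos (π / 6 + θ / 3) := by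
    rw [eA, eB]
    linear_combination (1 / 4) * hpq - 1 / 4 * cos (θ / 3) ^ 2 * h3
  have hA2 := sin_sq_add_cos_sq (π / 6 - θ / 3)
  have hB2 := sin_sq_add_cos_sq (π / 6 + θ / 3)
  have hsum : cos (π / 6 - θ / 3) + cos (π / 6 + θ / 3) = √3 * cos (θ / 3) := by
    rw [eA, eB]; ring
  have hprod : sin (π / 6 - θ / 3) * sin (π / 6 + θ / 3) = cos (θ / 3) ^ 2 - 3 / 4 := by
    rw [eA', eB']
    linear_combination (-3 / 4) * hpq - 1 / 4 * sin (θ / 3) ^ 2 * h3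
  rw [closedForm, hX]
  simp only [Pi.mul_apply]
  clear eA eB eA' eB' dA dB sA sB lA lB
  generalize Real.log (2 * cos (π / 6 - θ / 3)) = LA
  generalize Real.log (2 * cos (π / 6 + θ / 3)) = LB
  generalize cos (π / 6 - θ / 3) = A at *
  generalize cos (π / 6 + θ / 3) = B at *
  generalize sin (π / 6 - θ / 3) = a at *
  generalize sin (π / 6 + θ / 3) = b at *
  generalize cos (θ / 3) = p at *
  have hN : p * (8 * p ^ 4 - 8 * p ^ 2 + 9 / 2) / 6 = -2 * √3 / 9 *
      (-2 * (a * b) * (A + B) * (A * B) - (A + B) ^ 3 + 3 * (A * B) * (A + B)) := by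
    rw [hprod, hsum, ← hX]
    linear_combination (2 / 9 * (-2 * (p ^ 2 - 3 / 4) * p * (p ^ 2 - 1 / 4)
      + 3 * (p ^ 2 - 1 / 4) * p) - 2 / 9 * p ^ 3 * (√3 ^ 2 + 3)) * h3
  rw [show p * (8 * p ^ 4 - 8 * p ^ 2 + 9 / 2) / (6 * (A * B) ^ 2)
    = p * (8 * p ^ 4 - 8 * p ^ 2 + 9 / 2) / 6 / (A * B) ^ 2 by field_simp, hN]
  field_simp
  linear_combination 9 * B ^ 3 * hA2 + 9 * A ^ 3 * hB2

lemma cos_mul_powerSum_weightedCoeff {θ : ℝ} (h0 : 0 < θ) (h1 : θ < π / 2) :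
    cos θ * powerSum weightedCoeff (sin θ ^ 2) = closedForm θ := by
  have hcos : ∀ x ∈ Set.Icc 0 θ, 0 < cos x := fun x hx =>
    cos_pos_of_mem_Ioo ⟨by linarith [hx.1, pi_pos], by linarith [hx.2]⟩
  have hA : ∀ x ∈ Set.Icc 0 θ, 0 < cos (π / 6 - x / 3) := fun x hx =>
    cos_pos_of_mem_Ioo ⟨by linarith [hx.2, pi_pos], by linarith [hx.1, pi_pos]⟩
  have hB : ∀ x ∈ Set.Icc 0 θ, 0 < cos (π / 6 + x / 3) := fun x hx =>
    cos_pos_of_mem_Ioo ⟨by linarith [hx.1, pi_pos], by linarith [hx.2, pi_pos]⟩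
  have key := oscillator_eq_zero
    (δ := fun x => cos x * powerSum weightedCoeff (sin x ^ 2) - closedForm x)
    (δ₁ := fun x => trigSumDeriv weightedCoeff x - closedFormDeriv x) h0
    (fun x hx => (hasDerivAt_trigSum polyGrowth_weightedCoeff (hcos x hx)).sub
      (hasDerivAt_closedForm (hA x hx) (hB x hx)))
    (fun x hx => (hasDerivAt_trigSumDeriv polyGrowth_weightedCoeff weightedCoeff_succ
      (hcos x hx) (hasSum_sourceTerm (abs_sin_sq_lt_one (hcos x hx)))).sub
      (hasDerivAt_closedFormDeriv (hA x hx) (hB x hx)))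
    (fun x hx => by
      rw [four_mul_cos_mul_sourceTerm hx.1 (hx.2.trans h1)]
      ring)
    (by
      have h3 : √3 * √3 = 3 := Real.mul_self_sqrt (by norm_num)
      simp [powerSum_zero, weightedCoeff, hyperCoeff, harmonicFactor, harmonicNum, closedForm]
      rw [show 2 * (√3 / 2) = √3 by ring, Real.log_sqrt (by norm_num)]
      linear_combination (Real.log 3) * h3)
    (by
      simp [trigSumDeriv, closedFormDeriv])
  exact sub_eq_zero.1 key

theorem sun_3k_hbar_log (φ : ℝ) (h0 : 0 < φ) (h1 : φ < π / 3) :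
    ∑' k : ℕ, ((Nat.choose (3 * k) k : ℝ) / 27 ^ k) * (4 * cos (3 * φ / 2) ^ 2) ^ k *
        (3 * harmonicNum (3 * k) - 2 * harmonicNum (2 * k) - harmonicNum k - 3 * Real.log 3) =
      -(2 * Real.sqrt 3 / sin (3 * φ / 2)) *
        (cos (φ / 2) * Real.log (2 * cos (φ / 2 - π / 3)) +
          cos (φ / 2 - π / 3) * Real.log (2 * cos (φ / 2))) := by
  have key := cos_mul_powerSum_weightedCoeff (θ := π / 2 - 3 * φ / 2) (by linarith) (by linarith)
  have hs : 0 < sin (3 * φ / 2) := sin_pos_of_pos_of_lt_pi (by linarith) (by linarith)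
  rw [cos_pi_div_two_sub, sin_pi_div_two_sub, closedForm,
    show π / 6 - (π / 2 - 3 * φ / 2) / 3 = φ / 2 by ring,
    show π / 6 + (π / 2 - 3 * φ / 2) / 3 = -(φ / 2 - π / 3) by ring, cos_neg] at key
  have hsum : ∑' k : ℕ, ((Nat.choose (3 * k) k : ℝ) / 27 ^ k) * (4 * cos (3 * φ / 2) ^ 2) ^ k *
      (3 * harmonicNum (3 * k) - 2 * harmonicNum (2 * k) - harmonicNum k - 3 * Real.log 3) =
      powerSum weightedCoeff (cos (3 * φ / 2) ^ 2) :=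
    tsum_congr fun k => by
      rw [weightedCoeff, hyperCoeff, harmonicFactor, mul_pow]
      ring
  rw [hsum]
  rw [← mul_right_inj' hs.ne', key]
  generalize cos (φ / 2 - π / 3) = A
  generalize sin (3 * φ / 2) = s at hs
  field_simp
end
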